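/- If Δ, x:A ⊢ M : B is a valid typing judgment, then for every free instance x^{A'} of the variable x occurring in M one has A <: A'. -/

import Mathlib

/- The call-by-value linear lambda calculus of Selinger-Valiron:
   types, subtyping, indexed terms, values, erasure, contexts, typing rules. -/

namespace QLam

/-- Types: A,B ::= α | A ⊸ B | A ⊗ B | ⊤ | !A -/
inductive Ty : Type where
  | tconst : ℕ → Ty
  | arrow : Ty → Ty → Ty
  | tensor : Ty → Ty → Ty
  | unit : Ty
  | bang : Ty → Ty
deriving DecidableEq

/-- `bangN n A` is `!ⁿA`. -/
def bangN : ℕ → Ty → Ty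
  | 0, A => A
  | n + 1, A => Ty.bang (bangN n A)

/-- The subtyping relation `A <: B`. -/
inductive Sub : Ty → Ty → Prop where
  | tconst (n m a : ℕ) : (m = 0 ∨ 1 ≤ n) →
      Sub (bangN n (Ty.tconst a)) (bangN m (Ty.tconst a))
  | unit (n m : ℕ) : (m = 0 ∨ 1 ≤ n) →
      Sub (bangN n Ty.unit) (bangN m Ty.unit)
  | arrow (n m : ℕ) (A A' B B' : Ty) : (m = 0 ∨ 1 ≤ n) → Sub A A' → Sub B B' →
      Sub (bangN n (Ty.arrow A' B)) (bangN m (Ty.arrow A B'))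
  | tensor (n m : ℕ) (A A' B B' : Ty) : (m = 0 ∨ 1 ≤ n) → Sub A A' → Sub B B' →
      Sub (bangN n (Ty.tensor A B)) (bangN m (Ty.tensor A' B'))

/-- Indexed terms.  `letv x A M N` is `let x^A = M in N` (the abbreviation of
    `(λ⁰x^A.N) M`), `letPair n x A y B M N` is `let ⟨x^A,y^B⟩ⁿ = M in N`,
    `letUnit M N` is `let ∗ = M in N`, `star n` is `∗ⁿ`, `lam n x A M` is `λⁿx^A.M`. -/
inductive Tm : Type where
  | var : ℕ → Ty → Tm
  | cst : ℕ → Ty → Tm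
  | star : ℕ → Tm
  | lam : ℕ → ℕ → Ty → Tm → Tm
  | app : Tm → Tm → Tm
  | pair : ℕ → Tm → Tm → Tm
  | letv : ℕ → Ty → Tm → Tm → Tm
  | letPair : ℕ → ℕ → Ty → ℕ → Ty → Tm → Tm → Tm
  | letUnit : Tm → Tm → Tm
deriving DecidableEq

/-- Core values U ::= x^A | c^A | ∗ⁿ | λⁿx^A.M -/
inductive IsCoreValue : Tm → Prop where
  | var (x : ℕ) (A : Ty) : IsCoreValue (.var x A)
  | cst (c : ℕ) (A : Ty) : IsCoreValue (.cst c A)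
  | star (n : ℕ) : IsCoreValue (.star n)
  | lam (n x : ℕ) (A : Ty) (M : Tm) : IsCoreValue (.lam n x A M)

/-- Values V,W ::= U | ⟨V,W⟩ⁿ | let x^A = V in W | let ⟨x^A,y^B⟩ⁿ = V in W | let ∗ = V in W -/
inductive IsValue : Tm → Prop where
  | core {U : Tm} : IsCoreValue U → IsValue U
  | pair {V W : Tm} (n : ℕ) : IsValue V → IsValue W → IsValue (.pair n V W)
  | letv {V W : Tm} (x : ℕ) (A : Ty) : IsValue V → IsValue W → IsValue (.letv x A V W)
  | letPair {V W : Tm} (n x : ℕ) (A : Ty) (y : ℕ) (B : Ty) :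
      IsValue V → IsValue W → IsValue (.letPair n x A y B V W)
  | letUnit {V W : Tm} : IsValue V → IsValue W → IsValue (.letUnit V W)

/-- Untyped (pure) terms. -/
inductive PTm : Type where
  | var : ℕ → PTm
  | cst : ℕ → PTm
  | star : PTm
  | lam : ℕ → PTm → PTm
  | app : PTm → PTm → PTm
  | pair : PTm → PTm → PTm
  | letv : ℕ → PTm → PTm → PTm
  | letPair : ℕ → ℕ → PTm → PTm → PTm
  | letUnit : PTm → PTm → PTm
deriving DecidableEq

/-- The erasure operation, deleting all type and integer annotations. -/
def erase : Tm → PTm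
  | .var x _ => .var x
  | .cst c _ => .cst c
  | .star _ => .star
  | .lam _ x _ M => .lam x (erase M)
  | .app M N => .app (erase M) (erase N)
  | .pair _ M N => .pair (erase M) (erase N)
  | .letv x _ M N => .letv x (erase M) (erase N)
  | .letPair _ x _ y _ M N => .letPair x y (erase M) (erase N)
  | .letUnit M N => .letUnit (erase M) (erase N)

/-- `FreeAt x A M` : the term `M` has a free instance `x^A` of the variable `x`. -/
inductive FreeAt (x : ℕ) : Ty → Tm → Prop where
  | var (A : Ty) : FreeAt x A (.var x A)
  | lam {A : Ty} {M : Tm} (n y : ℕ) (B : Ty) : y ≠ x → FreeAt x A M →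
      FreeAt x A (.lam n y B M)
  | appL {A : Ty} {M : Tm} (N : Tm) : FreeAt x A M → FreeAt x A (.app M N)
  | appR {A : Ty} {N : Tm} (M : Tm) : FreeAt x A N → FreeAt x A (.app M N)
  | pairL {A : Ty} {M : Tm} (n : ℕ) (N : Tm) : FreeAt x A M → FreeAt x A (.pair n M N)
  | pairR {A : Ty} {N : Tm} (n : ℕ) (M : Tm) : FreeAt x A N → FreeAt x A (.pair n M N)
  | letvL {A : Ty} {M : Tm} (y : ℕ) (B : Ty) (N : Tm) : FreeAt x A M →
      FreeAt x A (.letv y B M N)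
  | letvR {A : Ty} {N : Tm} (y : ℕ) (B : Ty) (M : Tm) : y ≠ x → FreeAt x A N →
      FreeAt x A (.letv y B M N)
  | letPairL {A : Ty} {M : Tm} (n y : ℕ) (B : Ty) (z : ℕ) (C : Ty) (N : Tm) :
      FreeAt x A M → FreeAt x A (.letPair n y B z C M N)
  | letPairR {A : Ty} {N : Tm} (n y : ℕ) (B : Ty) (z : ℕ) (C : Ty) (M : Tm) :
      y ≠ x → z ≠ x → FreeAt x A N → FreeAt x A (.letPair n y B z C M N)
  | letUnitL {A : Ty} {M : Tm} (N : Tm) : FreeAt x A M → FreeAt x A (.letUnit M N)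
  | letUnitR {A : Ty} {N : Tm} (M : Tm) : FreeAt x A N → FreeAt x A (.letUnit M N)

/-- `x` occurs free in `M`. -/
def Free (x : ℕ) (M : Tm) : Prop := ∃ A, FreeAt x A M

/-- `x` occurs as a bound variable (binder) somewhere in `M`. -/
inductive BoundIn (x : ℕ) : Tm → Prop where
  | lamB (n : ℕ) (A : Ty) (M : Tm) : BoundIn x (.lam n x A M)
  | lamI {M : Tm} (n y : ℕ) (A : Ty) : BoundIn x M → BoundIn x (.lam n y A M)
  | appL {M : Tm} (N : Tm) : BoundIn x M → BoundIn x (.app M N)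
  | appR {N : Tm} (M : Tm) : BoundIn x N → BoundIn x (.app M N)
  | pairL {M : Tm} (n : ℕ) (N : Tm) : BoundIn x M → BoundIn x (.pair n M N)
  | pairR {N : Tm} (n : ℕ) (M : Tm) : BoundIn x N → BoundIn x (.pair n M N)
  | letvB (A : Ty) (M N : Tm) : BoundIn x (.letv x A M N)
  | letvL {M : Tm} (y : ℕ) (A : Ty) (N : Tm) : BoundIn x M → BoundIn x (.letv y A M N)
  | letvR {N : Tm} (y : ℕ) (A : Ty) (M : Tm) : BoundIn x N → BoundIn x (.letv y A M N)
  | letPairB1 (n : ℕ) (A : Ty) (z : ℕ) (B : Ty) (M N : Tm) :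
      BoundIn x (.letPair n x A z B M N)
  | letPairB2 (n y : ℕ) (A : Ty) (B : Ty) (M N : Tm) :
      BoundIn x (.letPair n y A x B M N)
  | letPairL {M : Tm} (n y : ℕ) (A : Ty) (z : ℕ) (B : Ty) (N : Tm) :
      BoundIn x M → BoundIn x (.letPair n y A z B M N)
  | letPairR {N : Tm} (n y : ℕ) (A : Ty) (z : ℕ) (B : Ty) (M : Tm) :
      BoundIn x N → BoundIn x (.letPair n y A z B M N)
  | letUnitL {M : Tm} (N : Tm) : BoundIn x M → BoundIn x (.letUnit M N)
  | letUnitR {N : Tm} (M : Tm) : BoundIn x N → BoundIn x (.letUnit M N)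

/-- Capture-avoiding (up to the usual variable conventions) substitution on untyped terms. -/
def psubst (x : ℕ) (V : PTm) : PTm → PTm
  | .var y => if y = x then V else .var y
  | .cst c => .cst c
  | .star => .star
  | .lam y M => if y = x then .lam y M else .lam y (psubst x V M)
  | .app M N => .app (psubst x V M) (psubst x V N)
  | .pair M N => .pair (psubst x V M) (psubst x V N)
  | .letv y M N => .letv y (psubst x V M) (if y = x then N else psubst x V N)
  | .letPair y z M N =>
      .letPair y z (psubst x V M) (if y = x ∨ z = x then N else psubst x V N)
  | .letUnit M N => .letUnit (psubst x V M) (psubst x V N)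

/-- Typing contexts: finite partial assignments of types to variables. -/
abbrev Ctx : Type := ℕ → Option Ty

/-- The empty context. -/
def emptyC : Ctx := fun _ => none

/-- Context extension `Δ, x:A`. -/
def extC (Δ : Ctx) (x : ℕ) (A : Ty) : Ctx := fun y => if y = x then some A else Δ y

/-- Disjointness of contexts. -/
def DisjC (Γ₁ Γ₂ : Ctx) : Prop := ∀ x, Γ₁ x = none ∨ Γ₂ x = none

/-- Union of contexts (left-biased; used on disjoint contexts). -/
def unionC (Γ₁ Γ₂ : Ctx) : Ctx := fun x => (Γ₁ x).orElse (fun _ => Γ₂ x)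

/-- `Δ` is of the form `!Δ'`: every type occurring in `Δ` is of the form `!B`. -/
def IsBangC (Δ : Ctx) : Prop := ∀ x A, Δ x = some A → ∃ B, A = Ty.bang B

/-- `!Δ`, obtained from `Δ` by prefixing every type with `!`. -/
def bangifyC (Δ : Ctx) : Ctx := fun x => (Δ x).map Ty.bang

/-- The typing rules of Table 1.  The parameter `cty` assigns to each constant `c`
    the type `A_c`; the type assigned to `c` is `!A_c`. -/
inductive Typing (cty : ℕ → Ty) : Ctx → Tm → Ty → Prop where
  | var {Δ : Ctx} {x : ℕ} {A B : Ty} :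
      IsBangC Δ → Δ x = none → Sub A B →
      Typing cty (extC Δ x A) (.var x B) B
  | cst {Δ : Ctx} {c : ℕ} {B : Ty} :
      IsBangC Δ → Sub (.bang (cty c)) B →
      Typing cty Δ (.cst c B) B
  | star {Δ : Ctx} {n : ℕ} :
      IsBangC Δ →
      Typing cty Δ (.star n) (bangN n .unit)
  | lam0 {Δ : Ctx} {x : ℕ} {A : Ty} {M : Tm} {B : Ty} :
      Δ x = none → Typing cty (extC Δ x A) M B →
      Typing cty Δ (.lam 0 x A M) (.arrow A B)
  | lamS {Δ : Ctx} {n x : ℕ} {A : Ty} {M : Tm} {B : Ty} :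
      IsBangC Δ → Δ x = none → Typing cty (extC Δ x A) M B →
      Typing cty Δ (.lam (n + 1) x A M) (bangN (n + 1) (.arrow A B))
  | app {Δ Γ₁ Γ₂ : Ctx} {M N : Tm} {A B : Ty} :
      IsBangC Δ → DisjC Γ₁ Γ₂ → DisjC Γ₁ Δ → DisjC Γ₂ Δ →
      Typing cty (unionC Γ₁ Δ) M (.arrow A B) →
      Typing cty (unionC Γ₂ Δ) N A →
      Typing cty (unionC Γ₁ (unionC Γ₂ Δ)) (.app M N) B
  | pair {Δ Γ₁ Γ₂ : Ctx} {n : ℕ} {M₁ M₂ : Tm} {A₁ A₂ : Ty} :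
      IsBangC Δ → DisjC Γ₁ Γ₂ → DisjC Γ₁ Δ → DisjC Γ₂ Δ →
      Typing cty (unionC Γ₁ Δ) M₁ (bangN n A₁) →
      Typing cty (unionC Γ₂ Δ) M₂ (bangN n A₂) →
      Typing cty (unionC Γ₁ (unionC Γ₂ Δ)) (.pair n M₁ M₂) (bangN n (.tensor A₁ A₂))
  | letv {Δ Γ₁ Γ₂ : Ctx} {x : ℕ} {A : Ty} {M N : Tm} {B : Ty} :
      IsBangC Δ → DisjC Γ₁ Γ₂ → DisjC Γ₁ Δ → DisjC Γ₂ Δ →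
      (unionC Γ₁ (unionC Γ₂ Δ)) x = none →
      Typing cty (unionC Γ₁ Δ) M A →
      Typing cty (extC (unionC Γ₂ Δ) x A) N B →
      Typing cty (unionC Γ₁ (unionC Γ₂ Δ)) (.letv x A M N) B
  | letUnit {Δ Γ₁ Γ₂ : Ctx} {M N : Tm} {A : Ty} :
      IsBangC Δ → DisjC Γ₁ Γ₂ → DisjC Γ₁ Δ → DisjC Γ₂ Δ →
      Typing cty (unionC Γ₁ Δ) M .unit →
      Typing cty (unionC Γ₂ Δ) N A →
      Typing cty (unionC Γ₁ (unionC Γ₂ Δ)) (.letUnit M N) A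
  | letPair {Δ Γ₁ Γ₂ : Ctx} {n x₁ : ℕ} {A₁ : Ty} {x₂ : ℕ} {A₂ : Ty} {M N : Tm} {A : Ty} :
      IsBangC Δ → DisjC Γ₁ Γ₂ → DisjC Γ₁ Δ → DisjC Γ₂ Δ →
      x₁ ≠ x₂ →
      (unionC Γ₁ (unionC Γ₂ Δ)) x₁ = none →
      (unionC Γ₁ (unionC Γ₂ Δ)) x₂ = none →
      Typing cty (unionC Γ₁ Δ) M (bangN n (.tensor A₁ A₂)) →
      Typing cty (extC (extC (unionC Γ₂ Δ) x₁ (bangN n A₁)) x₂ (bangN n A₂)) N A →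
      Typing cty (unionC Γ₁ (unionC Γ₂ Δ)) (.letPair n x₁ A₁ x₂ A₂ M N) A

/-- Pointwise subtyping of contexts with the same variables: `Δ' <: Δ`. -/
def SubCtx (Δ' Δ : Ctx) : Prop :=
  (∀ x, Δ x = none → Δ' x = none) ∧
  (∀ x A, Δ x = some A → ∃ A', Δ' x = some A' ∧ Sub A' A)

end QLam

namespace QLam

theorem extC_of_ne {Δ : Ctx} {x y : ℕ} {A : Ty} (h : y ≠ x) : extC Δ y A x = Δ x :=
  if_neg h.symm

theorem unionC_left_eq_some {Γ₁ Γ₂ Δ : Ctx} {x : ℕ} {A : Ty} (h₂ : DisjC Γ₂ Δ)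
    (h : unionC Γ₁ Δ x = some A) : unionC Γ₁ (unionC Γ₂ Δ) x = some A := by
  have h₂ := h₂ x
  cases h₁' : Γ₁ x <;> cases h₂' : Γ₂ x <;> simp_all [unionC]

theorem unionC_right_eq_some {Γ₁ Γ₂ Δ : Ctx} {x : ℕ} {A : Ty} (h₁₂ : DisjC Γ₁ Γ₂)
    (h₁ : DisjC Γ₁ Δ) (h : unionC Γ₂ Δ x = some A) :
    unionC Γ₁ (unionC Γ₂ Δ) x = some A := by
  have h₁₂ := h₁₂ x
  have h₁ := h₁ x
  cases h₁' : Γ₁ x <;> cases h₂' : Γ₂ x <;> simp_all [unionC]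

/-- Every free instance `x^{A'}` in a term typed in `Γ` has `x : A` in `Γ` with `A <: A'`. -/
theorem Typing.exists_sub_of_freeAt {cty : ℕ → Ty} {Γ : Ctx} {x : ℕ} {M : Tm} {B A' : Ty}
    (h : Typing cty Γ M B) (hf : FreeAt x A' M) : ∃ A, Γ x = some A ∧ Sub A A' := by
  induction h with
  | var _ _ hs => cases hf; exact ⟨_, if_pos rfl, hs⟩
  | cst => cases hf
  | star => cases hf
  | lam0 _ _ ih | lamS _ _ _ ih =>
    cases hf with
    | lam _ _ _ hne hf => simpa only [extC_of_ne hne] using ih hf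
  | app _ h₁₂ h₁ h₂ _ _ ihM ihN =>
    cases hf with
    | appL _ hf => exact (ihM hf).imp fun _ h => ⟨unionC_left_eq_some h₂ h.1, h.2⟩
    | appR _ hf => exact (ihN hf).imp fun _ h => ⟨unionC_right_eq_some h₁₂ h₁ h.1, h.2⟩
  | pair _ h₁₂ h₁ h₂ _ _ ihM ihN =>
    cases hf with
    | pairL _ _ hf => exact (ihM hf).imp fun _ h => ⟨unionC_left_eq_some h₂ h.1, h.2⟩
    | pairR _ _ hf => exact (ihN hf).imp fun _ h => ⟨unionC_right_eq_some h₁₂ h₁ h.1, h.2⟩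
  | letUnit _ h₁₂ h₁ h₂ _ _ ihM ihN =>
    cases hf with
    | letUnitL _ hf => exact (ihM hf).imp fun _ h => ⟨unionC_left_eq_some h₂ h.1, h.2⟩
    | letUnitR _ hf => exact (ihN hf).imp fun _ h => ⟨unionC_right_eq_some h₁₂ h₁ h.1, h.2⟩
  | letv _ h₁₂ h₁ h₂ _ _ _ ihM ihN =>
    cases hf with
    | letvL _ _ _ hf => exact (ihM hf).imp fun _ h => ⟨unionC_left_eq_some h₂ h.1, h.2⟩
    | letvR _ _ _ hne hf =>
      rw [extC_of_ne hne] at ihN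
      exact (ihN hf).imp fun _ h => ⟨unionC_right_eq_some h₁₂ h₁ h.1, h.2⟩
  | letPair _ h₁₂ h₁ h₂ _ _ _ _ _ ihM ihN =>
    cases hf with
    | letPairL _ _ _ _ _ _ hf => exact (ihM hf).imp fun _ h => ⟨unionC_left_eq_some h₂ h.1, h.2⟩
    | letPairR _ _ _ _ _ _ hne₁ hne₂ hf =>
      rw [extC_of_ne hne₂, extC_of_ne hne₁] at ihN
      exact (ihN hf).imp fun _ h => ⟨unionC_right_eq_some h₁₂ h₁ h.1, h.2⟩

/-- If `Δ, x:A ⊢ M : B` is a valid typing judgment, then for every free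
instance `x^{A'}` of the variable `x` occurring in `M` one has `A <: A'`. -/
theorem free_instances_are_supertypes (cty : ℕ → Ty) (Δ : Ctx) (x : ℕ) (A : Ty)
    (M : Tm) (B : Ty) (hx : Δ x = none) (h : Typing cty (extC Δ x A) M B) :
    ∀ A', FreeAt x A' M → Sub A A' := by
  intro A' hf
  obtain ⟨C, hC, hs⟩ := h.exists_sub_of_freeAt hf
  obtain rfl : A = C := by simpa [extC] using hC
  exact hs

end QLam
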